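/- There exists a constant c > 0 such that for every sufficiently large n there is a set P of points in the closed unit ball of ℝⁿ with |P| ≥ 2^{cn} such that every pair of distinct points x, y ∈ P satisfies √(1/3) ≤ ‖x - y‖₂ ≤ √(2/3). -/

import Mathlib

/-- Greedy (Gilbert–Varshamov) bound: a maximal `r`-clique in a finite type is large if every point
is in conflict with few points, itself included. -/
theorem exists_pairwise_card_le_mul {α : Type*} [Fintype α] (r : α → α → Prop)
    (hsymm : ∀ x y, r x y → r y x) (hirr : ∀ x, ¬ r x x) (B : ℝ)
    (hB : ∀ x, ((Set.ncard {y | ¬ r x y} : ℕ) : ℝ) ≤ B) :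
    ∃ P : Finset α, (∀ x ∈ P, ∀ y ∈ P, x ≠ y → r x y) ∧
      (Fintype.card α : ℝ) ≤ P.card * B := by
  classical
  obtain ⟨P, hP, hmax⟩ := Finset.exists_max_image
    (Finset.univ.filter fun P : Finset α => ∀ x ∈ P, ∀ y ∈ P, x ≠ y → r x y) Finset.card
    ⟨∅, by simp⟩
  simp only [Finset.mem_filter, Finset.mem_univ, true_and] at hP hmax
  refine ⟨P, hP, ?_⟩
  have hcover : (Finset.univ : Finset α) ⊆
      P.biUnion fun x => Finset.univ.filter fun y => ¬ r x y := by
    intro y _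
    by_contra hy
    simp only [Finset.mem_biUnion, Finset.mem_filter, Finset.mem_univ, true_and, not_exists,
      not_and, not_not] at hy
    have hyP : y ∉ P := fun h => hirr y (hy y h)
    have h := hmax (insert y P) <| by
      intro a ha b hb hab
      rcases Finset.mem_insert.1 ha with rfl | haP <;>
        rcases Finset.mem_insert.1 hb with rfl | hbP
      · exact absurd rfl hab
      · exact hsymm _ _ (hy b hbP)
      · exact hy a haP
      · exact hP a haP b hbP hab
    rw [Finset.card_insert_of_notMem hyP] at h
    omega
  calc (Fintype.card α : ℝ)
      ≤ ((P.biUnion fun x => Finset.univ.filter fun y => ¬ r x y).card : ℝ) := by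
        exact_mod_cast Finset.card_le_card hcover
    _ ≤ ∑ x ∈ P, ((Finset.univ.filter fun y => ¬ r x y).card : ℝ) := by
        exact_mod_cast Finset.card_biUnion_le
    _ ≤ ∑ _x ∈ P, B := by
        refine Finset.sum_le_sum fun x _ => ?_
        have h := hB x
        rwa [Set.ncard_eq_toFinset_card', Set.toFinset_ofPred] at h
    _ = P.card * B := by simp

/-- Chernoff-type bound on the number of subsets of `Fin n` whose size is not within
`[n / 3, 2 * n / 3]`. -/
theorem card_filter_unbalanced_le (n : ℕ) :
    ((Finset.univ.filter fun s : Finset (Fin n) =>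
      ¬ (n ≤ 3 * s.card ∧ 3 * s.card ≤ 2 * n)).card : ℝ) ≤ 2 * (189 / 100 : ℝ) ^ n := by
  have hsum (a b : ℝ) : ∑ s : Finset (Fin n), a ^ s.card * b ^ (n - s.card) = (a + b) ^ n := by
    simpa using Fin.sum_pow_mul_eq_add_pow a b
  have hweight (s : Finset (Fin n)) (hs : ¬ (n ≤ 3 * s.card ∧ 3 * s.card ≤ 2 * n)) :
      (4 / 5 : ℝ) ^ n ≤ (64 / 125) ^ s.card * 1 ^ (n - s.card) +
        1 ^ s.card * (64 / 125) ^ (n - s.card) := by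
    have hcube (k : ℕ) : (64 / 125 : ℝ) ^ k = (4 / 5) ^ (3 * k) := by
      rw [pow_mul]; norm_num
    have hle (k : ℕ) (hk : 3 * k ≤ n) : (4 / 5 : ℝ) ^ n ≤ (64 / 125) ^ k := by
      rw [hcube]
      exact pow_le_pow_of_le_one (by norm_num) (by norm_num) hk
    simp only [one_pow, mul_one, one_mul]
    rcases le_total (3 * s.card) n with h | h
    · linarith [hle _ h, pow_pos (show (0 : ℝ) < 64 / 125 by norm_num) (n - s.card)]
    · linarith [hle (n - s.card) (by omega), pow_pos (show (0 : ℝ) < 64 / 125 by norm_num) s.card]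
  have hmul : ((Finset.univ.filter fun s : Finset (Fin n) =>
      ¬ (n ≤ 3 * s.card ∧ 3 * s.card ≤ 2 * n)).card : ℝ) * (4 / 5) ^ n ≤
      2 * (189 / 125) ^ n := by
    rw [← nsmul_eq_mul]
    refine (Finset.card_nsmul_le_sum _ _ _ fun s hs =>
      hweight s (Finset.mem_filter.1 hs).2).trans ?_
    refine (Finset.sum_le_sum_of_subset_of_nonneg (Finset.filter_subset _ _)
      fun s _ _ => by positivity).trans ?_
    rw [Finset.sum_add_distrib, hsum, hsum]
    norm_num
    linarith
  rw [show (189 / 125 : ℝ) = 189 / 100 * (4 / 5) by norm_num, mul_pow, ← mul_assoc] at hmul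
  exact le_of_mul_le_mul_right hmul (by positivity)

open scoped symmDiff in
/-- An exponentially large binary code with all distances in `[n / 3, 2 * n / 3]`. -/
theorem exists_balanced_code (n : ℕ) :
    ∃ C : Finset (Finset (Fin n)),
      (∀ s ∈ C, ∀ t ∈ C, s ≠ t → n ≤ 3 * (s ∆ t).card ∧ 3 * (s ∆ t).card ≤ 2 * n) ∧
      (2 : ℝ) ^ n ≤ C.card * (2 * (189 / 100 : ℝ) ^ n) := by
  rcases Nat.eq_zero_or_pos n with rfl | hn
  · refine ⟨{∅}, by simp, by norm_num⟩
  obtain ⟨C, hC, hcard⟩ := exists_pairwise_card_le_mul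
    (fun s t : Finset (Fin n) => n ≤ 3 * (s ∆ t).card ∧ 3 * (s ∆ t).card ≤ 2 * n)
    (fun s t h => by rwa [symmDiff_comm t s])
    (fun s h => by simp at h; omega) (2 * (189 / 100 : ℝ) ^ n) (fun s => by
      refine le_trans ?_ (card_filter_unbalanced_le n)
      rw [Set.ncard_eq_toFinset_card', Set.toFinset_ofPred]
      norm_cast
      refine Finset.card_le_card_of_injOn (fun t => s ∆ t) ?_
        (symmDiff_right_injective s).injOn
      intro t ht
      simpa using ht)
  refine ⟨C, hC, ?_⟩
  simpa using hcard

/-- The indicator vector of `s`, scaled by `1 / √n`. -/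
noncomputable def scaledIndicator {n : ℕ} (s : Finset (Fin n)) : EuclideanSpace ℝ (Fin n) :=
  WithLp.toLp 2 fun i => if i ∈ s then (Real.sqrt n)⁻¹ else 0

theorem norm_scaledIndicator {n : ℕ} (s : Finset (Fin n)) :
    ‖scaledIndicator s‖ = Real.sqrt (s.card / n) := by
  rw [EuclideanSpace.norm_eq]
  congr 1
  simp [scaledIndicator, ite_pow, Finset.sum_ite_mem, div_eq_mul_inv]

open scoped symmDiff in
theorem norm_scaledIndicator_sub {n : ℕ} (s t : Finset (Fin n)) :
    ‖scaledIndicator s - scaledIndicator t‖ = Real.sqrt ((s ∆ t).card / n) := by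
  rw [← norm_scaledIndicator, EuclideanSpace.norm_eq, EuclideanSpace.norm_eq]
  congr 1
  refine Finset.sum_congr rfl fun i _ => ?_
  by_cases hs : i ∈ s <;> by_cases ht : i ∈ t <;>
    simp [scaledIndicator, Finset.mem_symmDiff, hs, ht]

theorem scaledIndicator_injective {n : ℕ} (hn : 0 < n) :
    Function.Injective (scaledIndicator (n := n)) := by
  intro s t h
  have hn' : (n : ℝ) ≠ 0 := by positivity
  have h0 := norm_scaledIndicator_sub s t
  rw [h, sub_self, norm_zero, eq_comm, Real.sqrt_eq_zero (by positivity)] at h0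
  simpa [hn', symmDiff_eq_bot, hn.ne'] using h0

/-- There is a constant `c > 0` such that for all sufficiently large `n` there
is a set of `2^{cn}` points in the unit ball of `ℝⁿ` whose pairwise distances
all lie in `[√(1/3), √(2/3)]`. -/
theorem well_separated_points_in_ball :
    ∃ c : ℝ, 0 < c ∧ ∃ N : ℕ, ∀ n : ℕ, N ≤ n →
      ∃ P : Finset (EuclideanSpace ℝ (Fin n)),
        (∀ x ∈ P, ‖x‖ ≤ 1) ∧
        (2 : ℝ) ^ (c * n) ≤ (P.card : ℝ) ∧
        (∀ x ∈ P, ∀ y ∈ P, x ≠ y →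
          Real.sqrt (1 / 3) ≤ ‖x - y‖ ∧ ‖x - y‖ ≤ Real.sqrt (2 / 3)) := by
  classical
  refine ⟨Real.logb 2 (51 / 50), Real.logb_pos (by norm_num) (by norm_num), 30, fun n hn => ?_⟩
  have hpos : 0 < n := by omega
  have hn' : (0 : ℝ) < n := by exact_mod_cast hpos
  obtain ⟨C, hC, hcard⟩ := exists_balanced_code n
  refine ⟨C.image scaledIndicator, ?_, ?_, ?_⟩
  · simp only [Finset.forall_mem_image]
    intro s _
    rw [norm_scaledIndicator, Real.sqrt_le_iff, one_pow, div_le_one hn']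
    refine ⟨zero_le_one, ?_⟩
    exact_mod_cast (Finset.card_le_univ s).trans_eq (Fintype.card_fin n)
  · rw [Finset.card_image_of_injective _ (scaledIndicator_injective hpos),
      Real.rpow_mul (by norm_num), Real.rpow_logb (by norm_num) (by norm_num) (by norm_num),
      Real.rpow_natCast]
    have hbern : (2 : ℝ) ≤ (31 / 30) ^ n := by
      have h := one_add_mul_le_pow (show (-2 : ℝ) ≤ 1 / 30 by norm_num) n
      have h30 : (30 : ℝ) ≤ n := by exact_mod_cast hn
      norm_num at h
      linarith
    have hprod : (31 / 30 : ℝ) ^ n * ((51 / 50) ^ n * (189 / 100) ^ n) ≤ 2 ^ n := by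
      rw [← mul_pow, ← mul_pow]
      exact pow_le_pow_left₀ (by norm_num) (by norm_num) n
    have hq : (0 : ℝ) < 2 * (189 / 100) ^ n := by positivity
    refine le_of_mul_le_mul_right (le_trans ?_ hcard) hq
    refine le_trans ?_ hprod
    have := mul_le_mul_of_nonneg_right hbern
      (show (0 : ℝ) ≤ (51 / 50) ^ n * (189 / 100) ^ n by positivity)
    linarith
  · simp only [Finset.forall_mem_image]
    intro s hs t ht hst
    obtain ⟨h₁, h₂⟩ := hC s hs t ht fun h => hst (congrArg _ h)
    rw [norm_scaledIndicator_sub]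
    refine ⟨Real.sqrt_le_sqrt ?_, Real.sqrt_le_sqrt ?_⟩
    · rw [div_le_div_iff₀ (by norm_num) hn']
      exact_mod_cast (by omega)
    · rw [div_le_div_iff₀ hn' (by norm_num)]
      exact_mod_cast (by omega)
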